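/- Let d ≥ 3, g(x) = |x|^{2-d}, β > 0, and let V : ℝ^d → ℝ be continuous, such that ∫ exp(-(β/2) N V(x)) dx < ∞ for N large enough, and such that (1-α₀)V satisfies lim_{|x|→∞} ((1-α₀)V(x)/2 + g(x)) = +∞ for some α₀ > 0. Then lim_{N→∞} (1/N²) log Z_{N,β} = -(β/2) min_{μ ∈ P(ℝ^d)} I_V(μ), where Z_{N,β} = ∫_{(ℝ^d)^N} exp(-(β/2) H_N(x₁,...,x_N)) dx₁...dx_N. -/

import Mathlib

open MeasureTheory Filter Topology
open scoped ENNReal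

noncomputable section

/-- The ambient Euclidean space `ℝ^d`. -/
abbrev Esp (d : ℕ) := EuclideanSpace ℝ (Fin d)

/-- The real-valued Coulomb kernel `g(x) = |x|^(2-d)` in dimension `d ≥ 3`. -/
def gC (d : ℕ) (x : Esp d) : ℝ := ‖x‖ ^ (2 - (d : ℝ))

/-- The [0,∞]-valued Coulomb kernel (equal to `+∞` at the origin). -/
def coulK (d : ℕ) (x : Esp d) : ℝ≥0∞ := (ENNReal.ofReal ‖x‖) ^ (2 - (d : ℝ))

/-- The Coulomb interaction energy `∬ g(x-y) dμ(x) dμ(y) ∈ [0,∞]`. -/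
def doubleEnergy (d : ℕ) (μ : Measure (Esp d)) : ℝ≥0∞ :=
  ∫⁻ p : Esp d × Esp d, coulK d (p.1 - p.2) ∂(μ.prod μ)

/-- Integral of a real-valued function against a measure, with values in the extended reals
(difference of the integrals of the positive and negative parts). -/
def eIntR {α : Type*} [MeasurableSpace α] (μ : Measure α) (f : α → ℝ) : EReal :=
  ((∫⁻ x, ENNReal.ofReal (f x) ∂μ : ℝ≥0∞) : EReal)
    - ((∫⁻ x, ENNReal.ofReal (- f x) ∂μ : ℝ≥0∞) : EReal)

/-- The mean-field energy functional `I_V(μ) = ∬ g(x-y) dμ(x)dμ(y) + ∫ V dμ ∈ (-∞, +∞]`. -/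
def IV (d : ℕ) (V : Esp d → ℝ) (μ : Measure (Esp d)) : EReal :=
  (doubleEnergy d μ : EReal) + eIntR μ V

/-- The `N`-point Hamiltonian `H_N(x₁,…,x_N) = Σ_{i≠j} g(x_i - x_j) + N Σ_i V(x_i)`. -/
def HN (d N : ℕ) (V : Esp d → ℝ) (X : Fin N → Esp d) : ℝ :=
  (∑ i, ∑ j, if i ≠ j then gC d (X i - X j) else 0) + N * ∑ i, V (X i)

/-- The partition function `Z_{N,β} = ∫ exp(-(β/2) H_N) dX_N`. -/
def ZN (d N : ℕ) (β : ℝ) (V : Esp d → ℝ) : ℝ≥0∞ :=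
  ∫⁻ X : Fin N → Esp d, ENNReal.ofReal (Real.exp (-(β / 2) * HN d N V X))

section CoulombKernel

variable {d : ℕ}

lemma continuous_coulK : Continuous (coulK d) :=
  ENNReal.continuous_rpow_const.comp (ENNReal.continuous_ofReal.comp continuous_norm)

lemma measurable_coulK : Measurable (coulK d) := continuous_coulK.measurable

lemma coulK_neg (x : Esp d) : coulK d (-x) = coulK d x := by simp [coulK]

lemma ennreal_rpow_anti {a b : ℝ≥0∞} {z : ℝ} (hz : z ≤ 0) (h : a ≤ b) : b ^ z ≤ a ^ z := by
  rw [← neg_neg z, ENNReal.rpow_neg, ENNReal.rpow_neg a]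
  exact ENNReal.inv_le_inv.2 (ENNReal.rpow_le_rpow h (by linarith))

lemma coulK_anti (hd : 3 ≤ d) {x y : Esp d} (h : ‖x‖ ≤ ‖y‖) : coulK d y ≤ coulK d x := by
  have hd' : (3 : ℝ) ≤ d := by exact_mod_cast hd
  exact ennreal_rpow_anti (by linarith) (ENNReal.ofReal_le_ofReal h)

lemma coulK_smul (t : ℝ) (ht : t ≠ 0) (x : Esp d) :
    coulK d (t • x) = ENNReal.ofReal |t| ^ (2 - (d : ℝ)) * coulK d x := by
  unfold coulK
  rw [norm_smul, Real.norm_eq_abs, ENNReal.ofReal_mul (abs_nonneg t)]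
  rcases eq_or_ne x 0 with rfl | hx
  · have h1 : ENNReal.ofReal |t| ≠ 0 := by simpa using ht
    rcases lt_trichotomy (2 - (d : ℝ)) 0 with h | h | h
    · simp only [norm_zero, ENNReal.ofReal_zero, mul_zero, ENNReal.zero_rpow_of_neg h]
      rw [ENNReal.mul_top]
      exact (ENNReal.rpow_pos (pos_iff_ne_zero.2 h1) ENNReal.ofReal_ne_top).ne'
    · simp [h]
    · simp [ENNReal.zero_rpow_of_pos h]
  · exact ENNReal.mul_rpow_of_ne_zero (by simpa using ht) (by simpa using hx) _

lemma coulK_zero (hd : 3 ≤ d) : coulK d 0 = ⊤ := by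
  have hd' : (3 : ℝ) ≤ d := by exact_mod_cast hd
  simp [coulK, ENNReal.zero_rpow_of_neg (show 2 - (d : ℝ) < 0 by linarith)]

lemma coulK_ne_top {x : Esp d} (hx : x ≠ 0) : coulK d x ≠ ⊤ :=
  ENNReal.rpow_ne_top_of_ne_zero (by simpa using hx) ENNReal.ofReal_ne_top

lemma coulK_eq_ofReal_gC {x : Esp d} (hx : x ≠ 0) : coulK d x = ENNReal.ofReal (gC d x) := by
  rw [coulK, gC, ENNReal.ofReal_rpow_of_pos (norm_pos_iff.2 hx)]

lemma ofReal_gC_le_coulK (hd : 3 ≤ d) (x : Esp d) : ENNReal.ofReal (gC d x) ≤ coulK d x := by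
  rcases eq_or_ne x 0 with rfl | hx
  · rw [coulK_zero hd]; exact le_top
  · exact (coulK_eq_ofReal_gC hx).ge

lemma gC_nonneg (x : Esp d) : 0 ≤ gC d x := Real.rpow_nonneg (norm_nonneg _) _

lemma measurable_gC : Measurable (gC d) := measurable_norm.pow_const _

/-- The constant in the doubling bound `coulK_le_of_norm_le_two_mul`. -/
def doublingConst (d : ℕ) : ℝ≥0∞ := ENNReal.ofReal (1 / 2) ^ (2 - (d : ℝ))

lemma doublingConst_ne_top : doublingConst d ≠ ⊤ :=
  ENNReal.rpow_ne_top_of_ne_zero (by simp) ENNReal.ofReal_ne_top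

lemma coulK_le_of_norm_le_two_mul (hd : 3 ≤ d) {x y : Esp d} (h : ‖x‖ ≤ 2 * ‖y‖) :
    coulK d y ≤ doublingConst d * coulK d x := by
  have h1 : coulK d y ≤ coulK d ((1 / 2 : ℝ) • x) := by
    apply coulK_anti hd
    rw [norm_smul]
    norm_num
    linarith
  rwa [coulK_smul _ (by norm_num), abs_of_pos (by norm_num)] at h1

lemma setLIntegral_coulK_ball_ne_top (hd : 3 ≤ d) (r : ℝ) :
    ∫⁻ x in Metric.ball (0 : Esp d) r, coulK d x ≠ ⊤ := by
  have : Nonempty (Fin d) := ⟨⟨0, by omega⟩⟩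
  have : Nontrivial (Esp d) := inferInstance
  have key : IntegrableOn (fun x : Esp d => ‖x‖ ^ (2 - (d : ℝ))) (Metric.ball 0 r) := by
    rw [integrableOn_fun_norm_addHaar volume (f := fun y : ℝ => y ^ (2 - (d : ℝ)))]
    have h : IntegrableOn (fun y : ℝ => y) (Set.Ioo 0 r) :=
      (continuous_id.integrableOn_Icc (a := 0) (b := r)).mono_set Set.Ioo_subset_Icc_self
    refine h.congr_fun (fun y hy => ?_) measurableSet_Ioo
    have hy0 : 0 < y := hy.1
    simp only [finrank_euclideanSpace, Fintype.card_fin, smul_eq_mul]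
    rw [← Real.rpow_natCast, ← Real.rpow_add hy0, Nat.cast_sub (by omega)]
    norm_num
  have h2 := key.lintegral_lt_top
  refine ne_of_lt (lt_of_eq_of_lt ?_ h2)
  refine lintegral_congr_ae (ae_restrict_of_ae ?_)
  filter_upwards [compl_mem_ae_iff.2 (measure_singleton (0 : Esp d))] with x hx
  exact coulK_eq_ofReal_gC hx

/-- The uniform probability measure on the unit ball. -/
def ballUniform (d : ℕ) : Measure (Esp d) :=
  ProbabilityTheory.cond volume (Metric.ball (0 : Esp d) 1)

lemma volume_unitBall_ne_zero : volume (Metric.ball (0 : Esp d) 1) ≠ 0 :=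
  (Metric.measure_ball_pos _ _ one_pos).ne'

lemma volume_unitBall_ne_top : volume (Metric.ball (0 : Esp d) 1) ≠ ⊤ := measure_ball_lt_top.ne

instance : IsProbabilityMeasure (ballUniform d) :=
  ProbabilityTheory.cond_isProbabilityMeasure_of_finite volume_unitBall_ne_zero
    volume_unitBall_ne_top

lemma ballUniform_eq : ballUniform d =
    (volume (Metric.ball (0 : Esp d) 1))⁻¹ • volume.restrict (Metric.ball 0 1) := rfl

lemma ae_ballUniform_norm_lt : ∀ᵐ u ∂(ballUniform d), ‖u‖ < 1 := by
  rw [ballUniform_eq]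
  refine Measure.ae_smul_measure ?_ _
  filter_upwards [ae_restrict_mem Metric.isOpen_ball.measurableSet] with u hu
  simpa using hu

lemma exists_lintegral_coulK_add_le (hd : 3 ≤ d) :
    ∃ C : ℝ≥0∞, C ≠ ⊤ ∧ ∀ x, ∫⁻ u, coulK d (x + u) ∂(ballUniform d) ≤ C := by
  refine ⟨(volume (Metric.ball (0 : Esp d) 1))⁻¹ *
    (∫⁻ x in Metric.ball (0 : Esp d) 3, coulK d x) + 1, ?_, fun x => ?_⟩
  · exact ENNReal.add_ne_top.2 ⟨ENNReal.mul_ne_top (ENNReal.inv_ne_top.2 volume_unitBall_ne_zero)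
      (setLIntegral_coulK_ball_ne_top hd 3), ENNReal.one_ne_top⟩
  rcases lt_or_ge ‖x‖ 2 with hx | hx
  · refine le_add_right ?_
    rw [ballUniform_eq, lintegral_smul_measure, smul_eq_mul]
    refine mul_le_mul_right ?_ _
    calc ∫⁻ u in Metric.ball (0 : Esp d) 1, coulK d (x + u)
        ≤ ∫⁻ u in (fun u => x + u) ⁻¹' Metric.ball (0 : Esp d) 3, coulK d (x + u) := by
          refine lintegral_mono_set fun u hu => ?_
          simp only [Metric.mem_ball, dist_zero_right, Set.mem_preimage] at hu ⊢
          linarith [norm_add_le x u]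
      _ = _ := (measurePreserving_add_left volume x).setLIntegral_comp_preimage
          measurableSet_ball measurable_coulK
  · refine le_add_left ?_
    calc ∫⁻ u, coulK d (x + u) ∂(ballUniform d) ≤ ∫⁻ _, 1 ∂(ballUniform d) := by
          refine lintegral_mono_ae ?_
          filter_upwards [ae_ballUniform_norm_lt] with u hu
          have h1 : 1 ≤ ‖x + u‖ := by
            have := norm_sub_le (x + u) u
            rw [add_sub_cancel_right] at this
            linarith
          have hd' : (3 : ℝ) ≤ d := by exact_mod_cast hd
          exact ENNReal.rpow_le_one_of_one_le_of_neg (ENNReal.one_le_ofReal.2 h1) (by linarith)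
      _ = 1 := by simp

lemma exists_lintegral_coulK_add_smul_le (hd : 3 ≤ d) :
    ∃ C : ℝ≥0∞, C ≠ ⊤ ∧ ∀ (ε : ℝ), ε ≠ 0 → ∀ x,
      ∫⁻ u, coulK d (x + ε • u) ∂(ballUniform d) ≤ C * coulK d x := by
  obtain ⟨A, hA, hA'⟩ := exists_lintegral_coulK_add_le hd
  have h2 : (ENNReal.ofReal 2) ^ (2 - (d : ℝ)) ≠ 0 :=
    (ENNReal.rpow_pos (by simp) (by simp)).ne'
  have base : ∀ x, ∫⁻ u, coulK d (x + u) ∂(ballUniform d) ≤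
      (doublingConst d + A * ((ENNReal.ofReal 2) ^ (2 - (d : ℝ)))⁻¹) * coulK d x := by
    intro x
    rw [add_mul]
    rcases lt_or_ge ‖x‖ 2 with hx | hx
    · refine le_add_left ((hA' x).trans ?_)
      have h3 : (ENNReal.ofReal 2) ^ (2 - (d : ℝ)) ≤ coulK d x := by
        have hd' : (3 : ℝ) ≤ d := by exact_mod_cast hd
        exact ennreal_rpow_anti (by linarith) (ENNReal.ofReal_le_ofReal hx.le)
      calc A = A * ((ENNReal.ofReal 2) ^ (2 - (d : ℝ)))⁻¹ * (ENNReal.ofReal 2) ^ (2 - (d : ℝ)) := by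
            rw [mul_assoc, ENNReal.inv_mul_cancel h2
              (ENNReal.rpow_ne_top_of_ne_zero (by simp) (by simp)), mul_one]
        _ ≤ _ := by gcongr
    · refine le_add_right ?_
      calc ∫⁻ u, coulK d (x + u) ∂(ballUniform d)
          ≤ ∫⁻ _, doublingConst d * coulK d x ∂(ballUniform d) := by
            refine lintegral_mono_ae ?_
            filter_upwards [ae_ballUniform_norm_lt] with u hu
            apply coulK_le_of_norm_le_two_mul hd
            have := norm_sub_le (x + u) u
            rw [add_sub_cancel_right] at this
            linarith
        _ = _ := by simp
  refine ⟨_, ENNReal.add_ne_top.2 ⟨doublingConst_ne_top (d := d), ENNReal.mul_ne_top hA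
    (ENNReal.inv_ne_top.2 h2)⟩, fun ε hε x => ?_⟩
  have h4 : ∀ u, coulK d (x + ε • u) =
      ENNReal.ofReal |ε| ^ (2 - (d : ℝ)) * coulK d (ε⁻¹ • x + u) := fun u => by
    rw [← coulK_smul ε hε, smul_add, smul_inv_smul₀ hε]
  have h5 : coulK d x = ENNReal.ofReal |ε| ^ (2 - (d : ℝ)) * coulK d (ε⁻¹ • x) := by
    rw [← coulK_smul ε hε, smul_inv_smul₀ hε]
  simp_rw [h4]
  rw [lintegral_const_mul _ (by have := @measurable_coulK d; fun_prop), h5, mul_left_comm]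
  gcongr
  exact base _

end CoulombKernel

section Mollification

variable {d : ℕ}

/-- The kernel `coulK d` averaged over independent perturbations of both points. -/
def smearedK (d : ℕ) (ε : ℝ) (x : Esp d) : ℝ≥0∞ :=
  ∫⁻ q : Esp d × Esp d, coulK d (x + ε • q.1 + (-ε) • q.2) ∂((ballUniform d).prod (ballUniform d))

/-- The law of `y + ε u`, where `y` has law `μ` and `u` is uniform on the unit ball. -/
def mollified (ε : ℝ) (μ : Measure (Esp d)) : Measure (Esp d) :=
  (μ.prod (ballUniform d)).map (fun p => p.1 + ε • p.2)

lemma measurable_add_smul (ε : ℝ) : Measurable (fun p : Esp d × Esp d => p.1 + ε • p.2) := by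
  fun_prop

instance (ε : ℝ) (μ : Measure (Esp d)) [IsProbabilityMeasure μ] :
    IsProbabilityMeasure (mollified ε μ) :=
  Measure.isProbabilityMeasure_map (measurable_add_smul ε).aemeasurable

lemma measurable_smearedK (ε : ℝ) : Measurable (smearedK d ε) := by
  have h : Measurable (fun p : Esp d × (Esp d × Esp d) =>
      coulK d (p.1 + ε • p.2.1 + (-ε) • p.2.2)) := by
    have := @measurable_coulK d
    fun_prop
  exact h.lintegral_prod_right'

lemma doubleEnergy_mollified (ε : ℝ) (μ : Measure (Esp d)) [IsProbabilityMeasure μ] :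
    doubleEnergy d (mollified ε μ) = ∫⁻ p, smearedK d ε (p.1 - p.2) ∂(μ.prod μ) := by
  have hK := @measurable_coulK d
  set η := ballUniform d
  have lhs : doubleEnergy d (mollified ε μ) =
      ∫⁻ y, ∫⁻ u, ∫⁻ y', ∫⁻ u', coulK d ((y + ε • u) - (y' + ε • u')) ∂η ∂μ ∂η ∂μ := by
    unfold doubleEnergy mollified
    rw [Measure.map_prod_map _ _ (measurable_add_smul ε) (measurable_add_smul ε),
      lintegral_map (by fun_prop) ((measurable_add_smul ε).prodMap (measurable_add_smul ε)),
      lintegral_prod _ (by simp only [Prod.map]; fun_prop)]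
    simp only [Prod.map]
    rw [lintegral_prod _ (Measurable.aemeasurable (Measurable.lintegral_prod_right' (f := fun
      r : (Esp d × Esp d) × (Esp d × Esp d) => coulK d ((r.1.1 + ε • r.1.2) - (r.2.1 + ε • r.2.2)))
      (by fun_prop)))]
    refine lintegral_congr fun y => lintegral_congr fun u => ?_
    rw [lintegral_prod _ (by fun_prop)]
  have rhs : ∫⁻ p, smearedK d ε (p.1 - p.2) ∂(μ.prod μ) =
      ∫⁻ y, ∫⁻ y', ∫⁻ u, ∫⁻ u', coulK d ((y - y') + ε • u + (-ε) • u') ∂η ∂η ∂μ ∂μ := by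
    have := @measurable_smearedK d ε
    rw [lintegral_prod _ (by fun_prop)]
    refine lintegral_congr fun y => lintegral_congr fun y' => ?_
    rw [smearedK, lintegral_prod _ (by fun_prop)]
  rw [lhs, rhs]
  refine lintegral_congr fun y => ?_
  rw [lintegral_lintegral_swap]
  · refine lintegral_congr fun y' => lintegral_congr fun u => lintegral_congr fun u' => ?_
    congr 1
    module
  · have h : Measurable (fun r : (Esp d × Esp d) × Esp d =>
        coulK d (y + ε • r.1.1 - (r.1.2 + ε • r.2))) := by fun_prop
    exact (h.lintegral_prod_right').aemeasurable

lemma exists_smearedK_le (hd : 3 ≤ d) :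
    ∃ C : ℝ≥0∞, C ≠ ⊤ ∧ ∀ ε : ℝ, ε ≠ 0 → ∀ x, smearedK d ε x ≤ C * coulK d x := by
  have hK := @measurable_coulK d
  obtain ⟨C, hC, hC'⟩ := exists_lintegral_coulK_add_smul_le hd
  refine ⟨C * C, ENNReal.mul_ne_top hC hC, fun ε hε x => ?_⟩
  rw [smearedK, lintegral_prod _ (by fun_prop)]
  calc ∫⁻ u, ∫⁻ u', coulK d (x + ε • u + (-ε) • u') ∂(ballUniform d) ∂(ballUniform d)
      ≤ ∫⁻ u, C * coulK d (x + ε • u) ∂(ballUniform d) :=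
        lintegral_mono fun u => hC' (-ε) (neg_ne_zero.2 hε) _
    _ = C * ∫⁻ u, coulK d (x + ε • u) ∂(ballUniform d) := lintegral_const_mul _ (by fun_prop)
    _ ≤ C * C * coulK d x := by
        rw [mul_assoc]
        gcongr
        exact hC' ε hε x

lemma tendsto_smearedK (hd : 3 ≤ d) {x : Esp d} (hx : x ≠ 0) :
    Tendsto (fun ε => smearedK d ε x) (𝓝[≠] 0) (𝓝 (coulK d x)) := by
  have hK := @measurable_coulK d
  have h0 : coulK d x = ∫⁻ _ : Esp d × Esp d, coulK d x
      ∂((ballUniform d).prod (ballUniform d)) := by simp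
  rw [h0]
  refine tendsto_lintegral_filter_of_dominated_convergence
    (fun _ => doublingConst d * coulK d x) (Eventually.of_forall fun ε => by fun_prop) ?_ ?_ ?_
  · have hpos : 0 < ‖x‖ / 4 := by positivity
    filter_upwards [mem_nhdsWithin_of_mem_nhds (Metric.ball_mem_nhds (0 : ℝ) hpos)] with ε hε
    have hε' : |ε| < ‖x‖ / 4 := by simpa using hε
    have h1 : ∀ᵐ q ∂((ballUniform d).prod (ballUniform d)), ‖q.1‖ < 1 :=
      Measure.quasiMeasurePreserving_fst.ae ae_ballUniform_norm_lt
    have h2 : ∀ᵐ q ∂((ballUniform d).prod (ballUniform d)), ‖q.2‖ < 1 :=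
      Measure.quasiMeasurePreserving_snd.ae ae_ballUniform_norm_lt
    filter_upwards [h1, h2] with q hq1 hq2
    apply coulK_le_of_norm_le_two_mul hd
    have e1 : ‖ε • q.1‖ ≤ ‖x‖ / 4 := by
      rw [norm_smul, Real.norm_eq_abs]; nlinarith [abs_nonneg ε, norm_nonneg q.1]
    have e2 : ‖(-ε) • q.2‖ ≤ ‖x‖ / 4 := by
      rw [norm_smul, Real.norm_eq_abs, abs_neg]; nlinarith [abs_nonneg ε, norm_nonneg q.2]
    have e3 : ‖x‖ ≤ ‖x + ε • q.1 + (-ε) • q.2‖ + ‖ε • q.1‖ + ‖(-ε) • q.2‖ := by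
      calc ‖x‖ = ‖(x + ε • q.1 + (-ε) • q.2) - ε • q.1 - (-ε) • q.2‖ := by congr 1; abel
        _ ≤ _ := (norm_sub_le _ _).trans (by gcongr; exact norm_sub_le _ _)
    linarith
  · simpa using ENNReal.mul_ne_top doublingConst_ne_top (coulK_ne_top hx)
  · refine Eventually.of_forall fun q => ?_
    have hc : Continuous (fun ε : ℝ => coulK d (x + ε • q.1 + (-ε) • q.2)) :=
      continuous_coulK.comp (by fun_prop)
    simpa using (hc.tendsto 0).mono_left nhdsWithin_le_nhds

lemma tendsto_doubleEnergy_mollified (hd : 3 ≤ d) (μ : Measure (Esp d)) [IsProbabilityMeasure μ]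
    (hμ : doubleEnergy d μ ≠ ⊤) :
    Tendsto (fun ε => doubleEnergy d (mollified ε μ)) (𝓝[≠] 0) (𝓝 (doubleEnergy d μ)) := by
  have hK := @measurable_coulK d
  obtain ⟨C, hC, hC'⟩ := exists_smearedK_le hd
  simp_rw [doubleEnergy_mollified]
  refine tendsto_lintegral_filter_of_dominated_convergence (fun p => C * coulK d (p.1 - p.2))
    (Eventually.of_forall fun ε => (measurable_smearedK ε).comp (by fun_prop)) ?_ ?_ ?_
  · filter_upwards [self_mem_nhdsWithin] with ε hε
    exact Eventually.of_forall fun p => hC' ε hε _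
  · rw [lintegral_const_mul _ (by fun_prop)]
    exact ENNReal.mul_ne_top hC hμ
  · filter_upwards [ae_lt_top (by fun_prop) hμ] with p hp
    refine tendsto_smearedK hd fun h => ?_
    rw [h, coulK_zero hd] at hp
    exact hp.ne rfl

lemma exists_mollified_le_smul_volume {ε : ℝ} (hε : ε ≠ 0) (μ : Measure (Esp d))
    [IsProbabilityMeasure μ] :
    ∃ M : ℝ≥0∞, M ≠ ⊤ ∧ mollified ε μ ≤ M • (volume : Measure (Esp d)) := by
  refine ⟨(volume (Metric.ball (0 : Esp d) 1))⁻¹ *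
    ENNReal.ofReal (abs (ε ^ Module.finrank ℝ (Esp d))⁻¹), ENNReal.mul_ne_top
      (ENNReal.inv_ne_top.2 volume_unitBall_ne_zero) ENNReal.ofReal_ne_top,
      Measure.le_iff.2 fun s hs => ?_⟩
  rw [mollified, Measure.map_apply (measurable_add_smul ε) hs,
    Measure.prod_apply (measurable_add_smul ε hs)]
  have key : ∀ y : Esp d, ballUniform d (Prod.mk y ⁻¹' ((fun p => p.1 + ε • p.2) ⁻¹' s)) ≤
      (volume (Metric.ball (0 : Esp d) 1))⁻¹ *
        ENNReal.ofReal (abs (ε ^ Module.finrank ℝ (Esp d))⁻¹) * volume s := by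
    intro y
    rw [ballUniform_eq, Measure.smul_apply, smul_eq_mul, mul_assoc]
    refine mul_le_mul_right ?_ _
    refine (Measure.restrict_apply_le _ _).trans ?_
    have e : Prod.mk y ⁻¹' ((fun p : Esp d × Esp d => p.1 + ε • p.2) ⁻¹' s) =
        (ε • ·) ⁻¹' ((y + ·) ⁻¹' s) := rfl
    rw [e, Measure.addHaar_preimage_smul volume hε, measure_preimage_add]
  calc _ ≤ ∫⁻ _, _ ∂μ := lintegral_mono key
    _ = _ := by simp

lemma tendsto_lintegral_mollified (μ : Measure (Esp d)) [IsProbabilityMeasure μ] {R : ℝ}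
    (hμ : ∀ᵐ x ∂μ, ‖x‖ ≤ R) {W : Esp d → ℝ} (hW : Continuous W) :
    Tendsto (fun ε => ∫⁻ x, ENNReal.ofReal (W x) ∂(mollified ε μ)) (𝓝[≠] 0)
      (𝓝 (∫⁻ x, ENNReal.ofReal (W x) ∂μ)) := by
  have hWm : Measurable W := hW.measurable
  have h0 : ∫⁻ x, ENNReal.ofReal (W x) ∂μ =
      ∫⁻ p, ENNReal.ofReal (W p.1) ∂(μ.prod (ballUniform d)) := by
    rw [lintegral_prod _ (by fun_prop)]; simp
  obtain ⟨B, hB⟩ := (isCompact_closedBall (0 : Esp d) (R + 1)).bddAbove_image hW.continuousOn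
  have h1 : ∀ ε, ∫⁻ x, ENNReal.ofReal (W x) ∂(mollified ε μ) =
      ∫⁻ p, ENNReal.ofReal (W (p.1 + ε • p.2)) ∂(μ.prod (ballUniform d)) := fun ε => by
    rw [mollified, lintegral_map (by fun_prop) (measurable_add_smul ε)]
  simp_rw [h1]
  rw [h0]
  refine tendsto_lintegral_filter_of_dominated_convergence (fun _ => ENNReal.ofReal B)
    (Eventually.of_forall fun ε => by fun_prop) ?_ (by simp) ?_
  · filter_upwards [mem_nhdsWithin_of_mem_nhds (Metric.ball_mem_nhds (0 : ℝ) one_pos)] with ε hε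
    have hε' : |ε| < 1 := by simpa using hε
    filter_upwards [Measure.quasiMeasurePreserving_fst.ae hμ,
      Measure.quasiMeasurePreserving_snd.ae ae_ballUniform_norm_lt] with p hp1 hp2
    refine ENNReal.ofReal_le_ofReal (hB ⟨_, ?_, rfl⟩)
    have e1 : ‖ε • p.2‖ ≤ 1 := by
      rw [norm_smul, Real.norm_eq_abs]; nlinarith [abs_nonneg ε, norm_nonneg p.2]
    simpa using (norm_add_le _ _).trans (add_le_add hp1 e1)
  · refine Eventually.of_forall fun p => ?_
    have hc : Continuous (fun ε : ℝ => ENNReal.ofReal (W (p.1 + ε • p.2))) :=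
      ENNReal.continuous_ofReal.comp (by fun_prop)
    simpa using (hc.tendsto 0).mono_left nhdsWithin_le_nhds

end Mollification

section MeanField

variable {d : ℕ}

/-- The mean-field energy with a nonnegative confining potential, with values in `[0, ∞]`. -/
def meanEnergy (d : ℕ) (W : Esp d → ℝ) (μ : Measure (Esp d)) : ℝ≥0∞ :=
  doubleEnergy d μ + ∫⁻ x, ENNReal.ofReal (W x) ∂μ

/-- The mean-field energy with the interaction kernel truncated at height `n`. -/
def cutEnergy (d : ℕ) (n : ℕ) (W : Esp d → ℝ) (μ : Measure (Esp d)) : ℝ≥0∞ :=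
  ∫⁻ p : Esp d × Esp d, min (coulK d (p.1 - p.2)) n ∂(μ.prod μ) + ∫⁻ x, ENNReal.ofReal (W x) ∂μ

lemma exists_bounded_support_meanEnergy_lt {W : Esp d → ℝ} {μ : Measure (Esp d)}
    [IsProbabilityMeasure μ] {a : ℝ≥0∞} (ha : meanEnergy d W μ < a) :
    ∃ ν : Measure (Esp d), IsProbabilityMeasure ν ∧ (∃ R : ℝ, ∀ᵐ x ∂ν, ‖x‖ ≤ R) ∧
      meanEnergy d W ν < a := by
  set s : ℕ → Set (Esp d) := fun n => Metric.closedBall 0 n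
  have hs : Tendsto (fun n => μ (s n)) atTop (𝓝 1) := by
    have h := tendsto_measure_iUnion_atTop (μ := μ) (s := s)
      (fun m n h => Metric.closedBall_subset_closedBall (by exact_mod_cast h))
    rwa [Metric.iUnion_closedBall_nat, measure_univ] at h
  have hinv : Tendsto (fun n => ((μ (s n))⁻¹ * (μ (s n))⁻¹) * meanEnergy d W μ) atTop
      (𝓝 (meanEnergy d W μ)) := by
    have h1 : Tendsto (fun n => (μ (s n))⁻¹) atTop (𝓝 1) := by
      simpa using tendsto_inv_iff.2 hs
    have h2 := ENNReal.Tendsto.mul h1 (Or.inl one_ne_zero) h1 (Or.inl one_ne_zero)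
    simpa using ENNReal.Tendsto.mul_const h2 (b := meanEnergy d W μ) (Or.inl (by simp))
  obtain ⟨n, hn, hn0⟩ := ((hinv.eventually_lt_const ha).and
    (hs.eventually_ne one_ne_zero)).exists
  refine ⟨ProbabilityTheory.cond μ (s n), ProbabilityTheory.cond_isProbabilityMeasure hn0,
    ⟨n, ?_⟩, lt_of_le_of_lt ?_ hn⟩
  · refine Measure.ae_smul_measure ?_ _
    filter_upwards [ae_restrict_mem Metric.isClosed_closedBall.measurableSet] with x hx
    exact mem_closedBall_zero_iff.1 hx
  · have h1 : (1 : ℝ≥0∞) ≤ (μ (s n))⁻¹ := ENNReal.one_le_inv.2 prob_le_one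
    unfold meanEnergy
    rw [mul_add]
    refine add_le_add ?_ ?_
    · unfold doubleEnergy ProbabilityTheory.cond
      rw [Measure.prod_smul_left, Measure.prod_smul_right, smul_smul, lintegral_smul_measure,
        Measure.prod_restrict, smul_eq_mul]
      exact mul_le_mul_right (setLIntegral_le_lintegral _ _) _
    · unfold ProbabilityTheory.cond
      rw [lintegral_smul_measure, smul_eq_mul]
      refine mul_le_mul' ?_ (setLIntegral_le_lintegral _ _)
      simpa using mul_le_mul_right h1 (μ (s n))⁻¹

lemma exists_le_smul_volume_meanEnergy_lt (hd : 3 ≤ d) {W : Esp d → ℝ} (hW : Continuous W)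
    {μ : Measure (Esp d)} [IsProbabilityMeasure μ] {a : ℝ≥0∞} (ha : meanEnergy d W μ < a) :
    ∃ ν : Measure (Esp d), IsProbabilityMeasure ν ∧
      (∃ M : ℝ≥0∞, M ≠ ⊤ ∧ ν ≤ M • (volume : Measure (Esp d))) ∧ meanEnergy d W ν < a := by
  obtain ⟨ν, hν, ⟨R, hR⟩, hlt⟩ := exists_bounded_support_meanEnergy_lt ha
  have hfin : doubleEnergy d ν ≠ ⊤ := fun h => by simp [meanEnergy, h] at hlt
  have hlim : Tendsto (fun ε => meanEnergy d W (mollified ε ν)) (𝓝[≠] 0)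
      (𝓝 (meanEnergy d W ν)) :=
    (tendsto_doubleEnergy_mollified hd ν hfin).add (tendsto_lintegral_mollified ν hR hW)
  obtain ⟨ε, hε, hε0⟩ := ((hlim.eventually_lt_const hlt).and self_mem_nhdsWithin).exists
  exact ⟨mollified ε ν, inferInstance, exists_mollified_le_smul_volume hε0 ν, hε⟩

lemma meanEnergy_ballUniform_ne_top (hd : 3 ≤ d) {W : Esp d → ℝ} (hW : Continuous W) :
    meanEnergy d W (ballUniform d) ≠ ⊤ := by
  have hK := @measurable_coulK d
  refine ENNReal.add_ne_top.2 ⟨?_, ?_⟩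
  · obtain ⟨C, hC, hC'⟩ := exists_lintegral_coulK_add_le hd
    refine ne_top_of_le_ne_top hC ?_
    rw [doubleEnergy, lintegral_prod _ (by fun_prop)]
    calc _ ≤ ∫⁻ _ : Esp d, C ∂(ballUniform d) := lintegral_mono fun x => by
          refine le_trans (le_of_eq (lintegral_congr fun y => ?_)) (hC' (-x))
          rw [← coulK_neg]
          congr 1
          abel
      _ = C := by simp
  · obtain ⟨B, hB⟩ := (isCompact_closedBall (0 : Esp d) 1).bddAbove_image hW.continuousOn
    refine ne_top_of_le_ne_top (ENNReal.ofReal_ne_top (r := B)) ?_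
    calc _ ≤ ∫⁻ _ : Esp d, ENNReal.ofReal B ∂(ballUniform d) := by
          refine lintegral_mono_ae ?_
          filter_upwards [ae_ballUniform_norm_lt] with x hx
          exact ENNReal.ofReal_le_ofReal (hB ⟨x, by simpa using hx.le, rfl⟩)
      _ = _ := by simp

lemma continuous_lintegral_min_natCast {X : Type*} [TopologicalSpace X] [MeasurableSpace X]
    [OpensMeasurableSpace X] {f : X → ℝ≥0∞} (hf : Continuous f) (n : ℕ) :
    Continuous (fun μ : ProbabilityMeasure X => ∫⁻ x, min (f x) n ∂(μ : Measure X)) := by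
  have hne : ∀ x, min (f x) n ≠ ⊤ := fun x =>
    ne_top_of_le_ne_top (ENNReal.natCast_ne_top n) (min_le_right _ _)
  have hc : Continuous (fun x => (min (f x) n).toNNReal) :=
    continuous_iff_continuousAt.2 fun x => (ENNReal.tendsto_toNNReal (hne x)).comp
      (hf.min continuous_const).continuousAt
  let g : BoundedContinuousFunction X NNReal := BoundedContinuousFunction.mkOfBound ⟨_, hc⟩ n <| by
    intro x y
    have hb : ∀ x, (min (f x) n).toNNReal ≤ n := fun x => by
      have := ENNReal.toNNReal_mono (ENNReal.natCast_ne_top n) (min_le_right (f x) n)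
      simpa using this
    rw [NNReal.dist_eq]
    have h1 := NNReal.coe_le_coe.2 (hb x)
    have h2 := NNReal.coe_le_coe.2 (hb y)
    simp only [NNReal.coe_natCast] at h1 h2
    exact abs_sub_le_of_nonneg_of_le (NNReal.coe_nonneg _) h1 (NNReal.coe_nonneg _) h2
  have hg : ∀ x, min (f x) n = (g x : ℝ≥0∞) := fun x => (ENNReal.coe_toNNReal (hne x)).symm
  simp_rw [hg]
  exact continuous_iff_continuousAt.2 fun μ =>
    ProbabilityMeasure.tendsto_iff_forall_lintegral_tendsto.1 tendsto_id g

lemma monotone_min_natCast (a : ℝ≥0∞) : Monotone (fun n : ℕ => min a (n : ℝ≥0∞)) :=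
  fun _ _ h => min_le_min_left _ (Nat.cast_le.2 h)

lemma iSup_min_natCast (a : ℝ≥0∞) : ⨆ n : ℕ, min a (n : ℝ≥0∞) = a := by
  have : Tendsto (fun n : ℕ => min a (n : ℝ≥0∞)) atTop (𝓝 (min a ⊤)) :=
    tendsto_const_nhds.min ENNReal.tendsto_nat_nhds_top
  rw [min_top_right] at this
  exact iSup_eq_of_tendsto (monotone_min_natCast a) this

lemma lintegral_eq_iSup_min {X : Type*} [MeasurableSpace X] {μ : Measure X} {f : X → ℝ≥0∞}
    (hf : Measurable f) : ∫⁻ x, f x ∂μ = ⨆ n : ℕ, ∫⁻ x, min (f x) n ∂μ := by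
  rw [← lintegral_iSup (fun n => hf.min measurable_const)
    fun m n hmn x => monotone_min_natCast (f x) hmn]
  simp_rw [iSup_min_natCast]

lemma isCompact_closure_lintegral_le {W : Esp d → ℝ} (hWm : Measurable W)
    (hW : Tendsto W (cocompact (Esp d)) atTop) (a : ℝ≥0∞) (ha : a ≠ ⊤) :
    IsCompact (closure {μ : ProbabilityMeasure (Esp d) |
      ∫⁻ x, ENNReal.ofReal (W x) ∂(μ : Measure (Esp d)) ≤ a}) := by
  refine isCompact_closure_of_isTightMeasureSet ?_
  rw [isTightMeasureSet_iff_exists_isCompact_measure_compl_le]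
  intro ε hε
  obtain ⟨L, hL0, hL⟩ : ∃ L : ℝ, 0 < L ∧ a / ENNReal.ofReal L ≤ ε := by
    have h : Tendsto (fun L : ℝ => a / ENNReal.ofReal L) atTop (𝓝 0) := by
      have := ENNReal.Tendsto.const_div (a := a) ENNReal.tendsto_ofReal_atTop (Or.inr ha)
      simpa using this
    obtain ⟨L, h1, h2⟩ := ((h.eventually_le_const hε).and (eventually_gt_atTop 0)).exists
    exact ⟨L, h2, h1⟩
  obtain ⟨K, hK, hKW⟩ := mem_cocompact.1 (hW.eventually_ge_atTop L)
  refine ⟨K, hK, ?_⟩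
  rintro _ ⟨μ, hμ, rfl⟩
  refine le_trans ?_ hL
  have hLne : ENNReal.ofReal L ≠ 0 := by simpa using hL0
  calc (μ : Measure (Esp d)) Kᶜ
      ≤ (μ : Measure (Esp d)) {x | ENNReal.ofReal L ≤ ENNReal.ofReal (W x)} :=
        measure_mono fun x hx => ENNReal.ofReal_le_ofReal (hKW hx)
    _ ≤ (∫⁻ x, ENNReal.ofReal (W x) ∂(μ : Measure (Esp d))) / ENNReal.ofReal L :=
        meas_ge_le_lintegral_div (by fun_prop) hLne ENNReal.ofReal_ne_top
    _ ≤ _ := by gcongr; exact hμ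

lemma exists_meanEnergy_le_of_cutEnergy_le {W : Esp d → ℝ} (hWc : Continuous W)
    (hW : Tendsto W (cocompact (Esp d)) atTop) {a : ℝ≥0∞} (ha : a ≠ ⊤)
    (h : ∀ n : ℕ, ∃ μ : ProbabilityMeasure (Esp d), cutEnergy d n W μ ≤ a) :
    ∃ μ : ProbabilityMeasure (Esp d), meanEnergy d W μ ≤ a := by
  have hK := @measurable_coulK d
  have hWm : Measurable W := hWc.measurable
  set t : ℕ → Set (ProbabilityMeasure (Esp d)) := fun n =>
    closure {μ : ProbabilityMeasure (Esp d) | cutEnergy d n W μ ≤ a}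
  have hmono : ∀ (m n : ℕ), m ≤ n → ∀ μ : ProbabilityMeasure (Esp d),
      cutEnergy d m W μ ≤ cutEnergy d n W μ := fun m n hmn μ =>
    add_le_add (lintegral_mono fun p => monotone_min_natCast _ hmn) le_rfl
  obtain ⟨μ, hμ⟩ := IsCompact.nonempty_iInter_of_sequence_nonempty_isCompact_isClosed t
    (fun n => closure_mono fun μ hμ => (hmono n (n + 1) (Nat.le_succ n) μ).trans hμ)
    (fun n => (h n).elim fun μ hμ => ⟨μ, subset_closure hμ⟩)
    ((isCompact_closure_lintegral_le hWm hW a ha).of_isClosed_subset isClosed_closure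
      (closure_mono fun μ hμ => le_trans (le_add_self (a := ∫⁻ x, ENNReal.ofReal (W x)
        ∂(μ : Measure (Esp d)))) hμ))
    (fun n => isClosed_closure)
  refine ⟨μ, ?_⟩
  have hpair : Continuous (fun μ : ProbabilityMeasure (Esp d) => μ.prod μ) :=
    ProbabilityMeasure.continuous_prod.comp (continuous_id.prodMk continuous_id)
  have hcont : ∀ n : ℕ, Continuous (fun μ : ProbabilityMeasure (Esp d) =>
      ∫⁻ p : Esp d × Esp d, min (coulK d (p.1 - p.2)) n ∂((μ : Measure (Esp d)).prod μ)
        + ∫⁻ x, min (ENNReal.ofReal (W x)) n ∂(μ : Measure (Esp d))) := fun n =>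
    ((continuous_lintegral_min_natCast (f := fun p : Esp d × Esp d => coulK d (p.1 - p.2))
      (continuous_coulK.comp (by fun_prop)) n).comp hpair).add
      (continuous_lintegral_min_natCast (ENNReal.continuous_ofReal.comp hWc) n)
  have hle : ∀ n : ℕ, ∫⁻ p : Esp d × Esp d, min (coulK d (p.1 - p.2)) n
      ∂((μ : Measure (Esp d)).prod μ)
        + ∫⁻ x, min (ENNReal.ofReal (W x)) n ∂(μ : Measure (Esp d)) ≤ a := fun n => by
    have hcl := isClosed_le (hcont n) (continuous_const (y := a))
    refine hcl.closure_subset_iff.2 (fun ν hν => ?_) (Set.mem_iInter.1 hμ n)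
    exact (add_le_add le_rfl (lintegral_mono fun x => min_le_left _ _)).trans hν
  rw [meanEnergy, doubleEnergy, lintegral_eq_iSup_min (μ := (μ : Measure (Esp d)).prod μ)
    (f := fun p : Esp d × Esp d => coulK d (p.1 - p.2)) (by fun_prop),
    lintegral_eq_iSup_min (f := fun x => ENNReal.ofReal (W x)) (by fun_prop),
    ENNReal.iSup_add_iSup_of_monotone]
  · exact iSup_le hle
  · exact fun m n hmn => lintegral_mono fun p => monotone_min_natCast _ hmn
  · exact fun m n hmn => lintegral_mono fun p => monotone_min_natCast _ hmn

end MeanField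

section PartitionFunction

variable {d N : ℕ}

lemma pi_le_smul_volume {ν : Measure (Esp d)} [IsProbabilityMeasure ν] {M : ℝ≥0∞} (hM : M ≠ ⊤)
    (h : ν ≤ M • (volume : Measure (Esp d))) :
    Measure.pi (fun _ : Fin N => ν) ≤ M ^ N • (volume : Measure (Fin N → Esp d)) := by
  lift M to NNReal using hM
  have : SigmaFinite ((M : ℝ≥0∞) • (volume : Measure (Esp d))) :=
    inferInstanceAs (SigmaFinite (M • (volume : Measure (Esp d))))
  have hpi : Measure.pi (fun _ : Fin N => (M : ℝ≥0∞) • (volume : Measure (Esp d))) =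
      (M : ℝ≥0∞) ^ N • (volume : Measure (Fin N → Esp d)) :=
    Measure.pi_eq fun s _ => by
      simp [volume_pi, Measure.pi_pi, Finset.prod_mul_distrib]
  rw [← hpi]
  refine Measure.le_iff.2 fun S hS => ?_
  rw [Measure.pi_def (μ := fun _ : Fin N => (M : ℝ≥0∞) • (volume : Measure (Esp d))),
    toMeasure_apply _ _ hS]
  refine (OuterMeasure.le_pi (n := (Measure.pi fun _ : Fin N => ν).toOuterMeasure)).2
    (fun s _ => ?_) S
  change Measure.pi (fun _ : Fin N => ν) (Set.univ.pi s) ≤ _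
  rw [Measure.pi_pi]
  exact Finset.prod_le_prod' fun i _ => h (s i)

lemma lintegral_prod_eval {f : Esp d → ℝ} (hf : Measurable f) (hf0 : ∀ x, 0 ≤ f x)
    (hfin : ∫⁻ x, ENNReal.ofReal (f x) ≠ ⊤) :
    ∫⁻ X : Fin N → Esp d, ENNReal.ofReal (∏ i, f (X i)) = (∫⁻ x, ENNReal.ofReal (f x)) ^ N := by
  have hint : Integrable f := lintegral_ofReal_ne_top_iff_integrable
    hf.aestronglyMeasurable (ae_of_all _ hf0) |>.1 hfin
  have hprod : Integrable (fun X : Fin N → Esp d => ∏ i, f (X i)) :=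
    Integrable.fintype_prod fun _ => hint
  rw [← ofReal_integral_eq_lintegral_ofReal hprod
    (ae_of_all _ fun X => Finset.prod_nonneg fun i _ => hf0 _),
    ← ofReal_integral_eq_lintegral_ofReal hint (ae_of_all _ hf0),
    integral_fintype_prod_volume_eq_pow, Fintype.card_fin,
    ENNReal.ofReal_pow (integral_nonneg hf0)]

lemma measurable_HN {W : Esp d → ℝ} (hW : Measurable W) : Measurable (HN d N W) := by
  have hg := @measurable_gC d
  unfold HN
  refine Measurable.add (Finset.measurable_sum _ fun i _ => Finset.measurable_sum _ fun j _ => ?_)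
    (by fun_prop)
  split_ifs <;> fun_prop

lemma mul_sum_le_HN (W : Esp d → ℝ) (X : Fin N → Esp d) : N * ∑ i, W (X i) ≤ HN d N W X := by
  refine le_add_of_nonneg_left (Finset.sum_nonneg fun i _ => Finset.sum_nonneg fun j _ => ?_)
  split_ifs
  exacts [gC_nonneg _, le_rfl]

lemma HN_nonneg {W : Esp d → ℝ} (hW0 : ∀ x, 0 ≤ W x) (X : Fin N → Esp d) : 0 ≤ HN d N W X :=
  le_trans (mul_nonneg (Nat.cast_nonneg _) (Finset.sum_nonneg fun _ _ => hW0 _))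
    (mul_sum_le_HN W X)

lemma ofReal_HN {W : Esp d → ℝ} (hW0 : ∀ x, 0 ≤ W x) (X : Fin N → Esp d) :
    ENNReal.ofReal (HN d N W X) =
      (∑ i, ∑ j, if i ≠ j then ENNReal.ofReal (gC d (X i - X j)) else 0) +
        N * ∑ i, ENNReal.ofReal (W (X i)) := by
  have h0 : ∀ i j, 0 ≤ if i ≠ j then gC d (X i - X j) else 0 := fun i j => by
    split_ifs
    exacts [gC_nonneg _, le_rfl]
  have hs := Finset.sum_nonneg fun (i : Fin N) (_ : i ∈ Finset.univ) => hW0 (X i)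
  rw [HN, ENNReal.ofReal_add (Finset.sum_nonneg fun i _ => Finset.sum_nonneg fun j _ => h0 i j)
    (mul_nonneg (Nat.cast_nonneg _) hs), ENNReal.ofReal_mul (Nat.cast_nonneg _),
    ENNReal.ofReal_natCast, ENNReal.ofReal_sum_of_nonneg fun i _ => hW0 (X i),
    ENNReal.ofReal_sum_of_nonneg fun i _ => Finset.sum_nonneg fun j _ => h0 i j]
  congr 1
  refine Finset.sum_congr rfl fun i _ => ?_
  rw [ENNReal.ofReal_sum_of_nonneg fun j _ => h0 i j]
  refine Finset.sum_congr rfl fun j _ => ?_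
  split_ifs <;> simp

lemma lintegral_coulK_pair (ν : Measure (Esp d)) [IsProbabilityMeasure ν] {i j : Fin N}
    (hij : i ≠ j) :
    ∫⁻ X, coulK d (X i - X j) ∂(Measure.pi fun _ : Fin N => ν) = doubleEnergy d ν := by
  have hK := @measurable_coulK d
  have hind := (ProbabilityTheory.iIndepFun_pi (μ := fun _ : Fin N => ν)
    (X := fun _ x => x) fun _ => aemeasurable_id).indepFun hij
  have hmap := (ProbabilityTheory.indepFun_iff_map_prod_eq_prod_map_map
    (measurable_pi_apply i).aemeasurable (measurable_pi_apply j).aemeasurable).1 hind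
  have hi : ∀ i : Fin N, (Measure.pi fun _ : Fin N => ν).map (fun X => X i) = ν := fun i =>
    (measurePreserving_eval (fun _ : Fin N => ν) i).map_eq
  rw [hi, hi] at hmap
  rw [doubleEnergy, ← hmap, lintegral_map (by fun_prop) (by fun_prop)]

lemma lintegral_HN_le (hd : 3 ≤ d) {W : Esp d → ℝ} (hW : Measurable W) (hW0 : ∀ x, 0 ≤ W x)
    (ν : Measure (Esp d)) [IsProbabilityMeasure ν] :
    ∫⁻ X, ENNReal.ofReal (HN d N W X) ∂(Measure.pi fun _ : Fin N => ν) ≤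
      (N : ℝ≥0∞) ^ 2 * meanEnergy d W ν := by
  have hK := @measurable_coulK d
  have hm : ∀ i j : Fin N, Measurable
      fun X : Fin N → Esp d => if i ≠ j then coulK d (X i - X j) else 0 := fun i j => by
    split_ifs <;> fun_prop
  calc ∫⁻ X, ENNReal.ofReal (HN d N W X) ∂(Measure.pi fun _ : Fin N => ν)
      ≤ ∫⁻ X, ((∑ i, ∑ j, if i ≠ j then coulK d (X i - X j) else 0) +
        N * ∑ i, ENNReal.ofReal (W (X i))) ∂(Measure.pi fun _ : Fin N => ν) := by
        refine lintegral_mono fun X => ?_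
        rw [ofReal_HN hW0]
        gcongr with i _ j _
        split_ifs
        exacts [ofReal_gC_le_coulK hd _, le_rfl]
    _ = (∑ i : Fin N, ∑ j : Fin N, ∫⁻ X, (if i ≠ j then coulK d (X i - X j) else 0)
          ∂(Measure.pi fun _ : Fin N => ν)) +
        N * ∑ i : Fin N, ∫⁻ X, ENNReal.ofReal (W (X i)) ∂(Measure.pi fun _ : Fin N => ν) := by
        rw [lintegral_add_right _ (by fun_prop), lintegral_const_mul _ (by fun_prop),
          lintegral_finsetSum _ fun i _ => Finset.measurable_sum _ fun j _ => hm i j]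
        congr 1
        swap
        · rw [lintegral_finsetSum _ fun i _ => by fun_prop]
        exact Finset.sum_congr rfl fun i _ => lintegral_finsetSum _ fun j _ => hm i j
    _ ≤ (∑ _i : Fin N, ∑ _j : Fin N, doubleEnergy d ν) +
        N * ∑ _i : Fin N, ∫⁻ x, ENNReal.ofReal (W x) ∂ν := by
        gcongr with i _ j _ i _
        · split_ifs with hij
          · exact (lintegral_coulK_pair ν hij).le
          · simp
        · exact ((measurePreserving_eval (fun _ : Fin N => ν) i).lintegral_comp
            (f := fun x => ENNReal.ofReal (W x)) (by fun_prop)).le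
    _ = _ := by
        simp only [Finset.sum_const, Finset.card_univ, Fintype.card_fin, nsmul_eq_mul, meanEnergy]
        ring

lemma exp_neg_meanEnergy_le_ZN (hd : 3 ≤ d) {β : ℝ} (hβ : 0 < β) {W : Esp d → ℝ}
    (hW : Measurable W) (hW0 : ∀ x, 0 ≤ W x) {ν : Measure (Esp d)} [IsProbabilityMeasure ν]
    {M : ℝ≥0∞} (hM : M ≠ ⊤) (hν : ν ≤ M • (volume : Measure (Esp d))) {a : ℝ} (ha0 : 0 ≤ a)
    (ha : meanEnergy d W ν ≤ ENNReal.ofReal a) :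
    ENNReal.ofReal (Real.exp (-(β / 2) * (N ^ 2 * a))) ≤ M ^ N * ZN d N β W := by
  have hHm : Measurable (HN d N W) := measurable_HN hW
  have hle : ∫⁻ X, ENNReal.ofReal (HN d N W X) ∂(Measure.pi fun _ : Fin N => ν) ≤
      ENNReal.ofReal (N ^ 2 * a) := by
    refine (lintegral_HN_le hd hW hW0 ν).trans ?_
    rw [ENNReal.ofReal_mul (by positivity), ENNReal.ofReal_pow (Nat.cast_nonneg _),
      ENNReal.ofReal_natCast]
    gcongr
  have hint : Integrable (HN d N W) (Measure.pi fun _ : Fin N => ν) :=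
    (lintegral_ofReal_ne_top_iff_integrable hHm.aestronglyMeasurable
      (ae_of_all _ (HN_nonneg hW0))).1 (ne_top_of_le_ne_top ENNReal.ofReal_ne_top hle)
  have hexp : Integrable (fun X => Real.exp (-(β / 2) * HN d N W X))
      (Measure.pi fun _ : Fin N => ν) := by
    refine Integrable.of_bound (by fun_prop) 1 (ae_of_all _ fun X => ?_)
    rw [Real.norm_eq_abs, Real.abs_exp, Real.exp_le_one_iff]
    nlinarith [HN_nonneg (N := N) hW0 X]
  have hmean : ∫ X, HN d N W X ∂(Measure.pi fun _ : Fin N => ν) ≤ N ^ 2 * a := by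
    rw [integral_eq_lintegral_of_nonneg_ae (ae_of_all _ (HN_nonneg hW0))
      hHm.aestronglyMeasurable]
    exact ENNReal.toReal_le_of_le_ofReal (by positivity) hle
  have hjensen := convexOn_exp.map_integral_le Real.continuous_exp.continuousOn isClosed_univ
    (ae_of_all _ fun _ => Set.mem_univ _) (hint.const_mul (-(β / 2))) hexp
  rw [integral_const_mul] at hjensen
  calc ENNReal.ofReal (Real.exp (-(β / 2) * (N ^ 2 * a)))
      ≤ ENNReal.ofReal (∫ X, Real.exp (-(β / 2) * HN d N W X)
          ∂(Measure.pi fun _ : Fin N => ν)) := by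
        refine ENNReal.ofReal_le_ofReal (le_trans (Real.exp_le_exp.2 ?_) hjensen)
        nlinarith
    _ = ∫⁻ X, ENNReal.ofReal (Real.exp (-(β / 2) * HN d N W X))
          ∂(Measure.pi fun _ : Fin N => ν) :=
        ofReal_integral_eq_lintegral_ofReal hexp (ae_of_all _ fun X => (Real.exp_pos _).le)
    _ ≤ ∫⁻ X, ENNReal.ofReal (Real.exp (-(β / 2) * HN d N W X))
          ∂(M ^ N • (volume : Measure (Fin N → Esp d))) :=
        lintegral_mono' (pi_le_smul_volume hM hν) le_rfl
    _ = _ := by rw [lintegral_smul_measure, smul_eq_mul, ZN]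

/-- The empirical measure of a configuration of `N` points. -/
def empirical (X : Fin N → Esp d) : Measure (Esp d) :=
  (N : ℝ≥0∞)⁻¹ • ∑ i, Measure.dirac (X i)

instance [NeZero N] (X : Fin N → Esp d) : IsProbabilityMeasure (empirical X) :=
  ⟨by simp [empirical, ENNReal.inv_mul_cancel, NeZero.ne N]⟩

lemma lintegral_empirical (X : Fin N → Esp d) (f : Esp d → ℝ≥0∞) :
    ∫⁻ x, f x ∂(empirical X) = (N : ℝ≥0∞)⁻¹ * ∑ i, f (X i) := by
  simp [empirical, lintegral_smul_measure, lintegral_finsetSum_measure]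

lemma mul_cutEnergy_empirical_le [NeZero N] {W : Esp d → ℝ} (hW0 : ∀ x, 0 ≤ W x) (n : ℕ)
    {X : Fin N → Esp d} (hX : Function.Injective X) :
    (N : ℝ≥0∞) ^ 2 * cutEnergy d n W (empirical X) ≤ ENNReal.ofReal (HN d N W X) + N * n := by
  have hK := @measurable_coulK d
  have hN : (N : ℝ≥0∞) * (N : ℝ≥0∞)⁻¹ = 1 :=
    ENNReal.mul_inv_cancel (by simp [NeZero.ne N]) (ENNReal.natCast_ne_top N)
  have hpair : ∫⁻ p : Esp d × Esp d, min (coulK d (p.1 - p.2)) n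
      ∂((empirical X).prod (empirical X)) =
      (N : ℝ≥0∞)⁻¹ * ((N : ℝ≥0∞)⁻¹ * ∑ i, ∑ j, min (coulK d (X i - X j)) n) := by
    rw [lintegral_prod _ (by fun_prop)]
    simp_rw [lintegral_empirical, Finset.mul_sum]
  have hsum : ∑ i, ∑ j, min (coulK d (X i - X j)) n ≤
      (∑ i, ∑ j, if i ≠ j then ENNReal.ofReal (gC d (X i - X j)) else 0) + N * n := by
    calc ∑ i, ∑ j, min (coulK d (X i - X j)) n
        ≤ ∑ i : Fin N, ∑ j : Fin N, ((if i ≠ j then ENNReal.ofReal (gC d (X i - X j)) else 0) +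
            if i = j then (n : ℝ≥0∞) else 0) := by
          gcongr with i _ j _
          by_cases h : i = j
          · simp [h]
          · simp only [ne_eq, h, not_false_eq_true, if_true, if_false, add_zero]
            rw [← coulK_eq_ofReal_gC (sub_ne_zero.2 (hX.ne h))]
            exact min_le_left _ _
      _ = _ := by simp [Finset.sum_add_distrib]
  rw [cutEnergy, hpair, lintegral_empirical, ofReal_HN hW0]
  calc _ = ((N : ℝ≥0∞) * (N : ℝ≥0∞)⁻¹) * ((N : ℝ≥0∞) * (N : ℝ≥0∞)⁻¹) *
        (∑ i, ∑ j, min (coulK d (X i - X j)) n) +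
        ((N : ℝ≥0∞) * (N : ℝ≥0∞)⁻¹) * (N * ∑ i, ENNReal.ofReal (W (X i))) := by ring
    _ ≤ _ := by
      rw [hN, one_mul, one_mul, one_mul]
      refine (add_le_add_left hsum _).trans_eq ?_
      ring

lemma ae_injective (hd : 3 ≤ d) : ∀ᵐ X : Fin N → Esp d, Function.Injective X := by
  have h : ∀ i j : Fin N, i ≠ j → ∀ᵐ X : Fin N → Esp d, X i ≠ X j := fun i j hij => by
    let s : Submodule ℝ (Fin N → Esp d) := LinearMap.ker
      (LinearMap.proj (R := ℝ) (φ := fun _ : Fin N => Esp d) i - LinearMap.proj j)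
    have hs : s ≠ ⊤ := fun htop => by
      have : Nonempty (Fin d) := ⟨⟨0, by omega⟩⟩
      obtain ⟨v, hv⟩ := exists_ne (0 : Esp d)
      have hmem : Pi.single i v ∈ s := htop ▸ Submodule.mem_top
      simp [s, hij.symm] at hmem
      exact hv hmem
    refine measure_mono_null (fun X hX => ?_) (Measure.addHaar_submodule volume s hs)
    simpa [s, sub_eq_zero] using hX
  have hall : ∀ᵐ X : Fin N → Esp d, ∀ i j, i ≠ j → X i ≠ X j := by
    simp only [ae_all_iff]
    exact h
  filter_upwards [hall] with X hX i j hij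
  by_contra hne
  exact hX i j hne hij

lemma ZN_le [NeZero N] (hd : 3 ≤ d) {β : ℝ} (hβ : 0 < β) {W : Esp d → ℝ} (hW : Measurable W)
    (hW0 : ∀ x, 0 ≤ W x) {n N₀ : ℕ} (hN : N₀ ≤ N) {a : ℝ}
    (ha : ∀ μ : ProbabilityMeasure (Esp d), ENNReal.ofReal a ≤ cutEnergy d n W μ)
    (hfin : ∫⁻ x, ENNReal.ofReal (Real.exp (-(β / 2) * N₀ * W x)) ≠ ⊤) :
    ZN d N β W ≤ ENNReal.ofReal (Real.exp (-(β / 2) * ((1 - N₀ / N) * (N ^ 2 * a - N * n)))) *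
      (∫⁻ x, ENNReal.ofReal (Real.exp (-(β / 2) * N₀ * W x))) ^ N := by
  have hNpos : (0 : ℝ) < N := by exact_mod_cast NeZero.pos N
  rw [← lintegral_prod_eval (f := fun x => Real.exp (-(β / 2) * N₀ * W x)) (by fun_prop)
    (fun _ => (Real.exp_pos _).le) hfin, ← lintegral_const_mul _ (by fun_prop), ZN]
  refine lintegral_mono_ae ?_
  filter_upwards [ae_injective hd] with X hX
  have hlow : N ^ 2 * a - N * n ≤ HN d N W X := by
    have h := (mul_le_mul_right (ha ⟨empirical X, inferInstance⟩) ((N : ℝ≥0∞) ^ 2)).trans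
      (mul_cutEnergy_empirical_le hW0 n hX)
    rw [← ENNReal.ofReal_natCast N, ← ENNReal.ofReal_natCast n,
      ← ENNReal.ofReal_pow (Nat.cast_nonneg _), ← ENNReal.ofReal_mul (by positivity),
      ← ENNReal.ofReal_mul (by positivity),
      ← ENNReal.ofReal_add (HN_nonneg hW0 X) (by positivity),
      ENNReal.ofReal_le_ofReal_iff (add_nonneg (HN_nonneg hW0 X) (by positivity))] at h
    linarith
  rw [← Real.exp_sum, ← ENNReal.ofReal_mul (Real.exp_pos _).le, ← Real.exp_add]
  refine ENNReal.ofReal_le_ofReal (Real.exp_le_exp.2 ?_)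
  have hr0 : (0 : ℝ) ≤ N₀ / N := by positivity
  have hr1 : (N₀ : ℝ) / N ≤ 1 := (div_le_one hNpos).2 (by exact_mod_cast hN)
  have h1 := mul_le_mul_of_nonneg_left hlow (sub_nonneg.2 hr1)
  have h2 := mul_le_mul_of_nonneg_left (mul_sum_le_HN W X) hr0
  rw [← mul_assoc, div_mul_cancel₀ _ hNpos.ne'] at h2
  rw [← Finset.mul_sum]
  nlinarith

end PartitionFunction

section Asymptotics

variable {d : ℕ}

lemma tendsto_inv_sq_mul_log {Z : ℕ → ℝ≥0∞} {L : ℝ}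
    (hlow : ∀ l < L, ∀ᶠ N : ℕ in atTop, ENNReal.ofReal (Real.exp ((N : ℝ) ^ 2 * l)) ≤ Z N)
    (hupp : ∀ l > L, ∀ᶠ N : ℕ in atTop, Z N ≤ ENNReal.ofReal (Real.exp ((N : ℝ) ^ 2 * l))) :
    Tendsto (fun N : ℕ => ((((N : ℝ) ^ 2)⁻¹ : ℝ) : EReal) * ENNReal.log (Z N)) atTop
      (𝓝 (L : EReal)) := by
  have hlog : ∀ t : ℝ, ENNReal.log (ENNReal.ofReal (Real.exp t)) = (t : EReal) := fun t => by
    rw [ENNReal.log_ofReal_of_pos (Real.exp_pos t), Real.log_exp]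
  have hcancel : ∀ (N : ℕ) (l : ℝ), 1 ≤ N →
      ((((N : ℝ) ^ 2)⁻¹ : ℝ) : EReal) * ((((N : ℝ) ^ 2 * l : ℝ)) : EReal) = l := fun N l hN => by
    have hN' : (N : ℝ) ≠ 0 := by exact_mod_cast (by omega : N ≠ 0)
    rw [← EReal.coe_mul]
    congr 1
    field_simp
  have hnn : ∀ N : ℕ, (0 : EReal) ≤ ((((N : ℝ) ^ 2)⁻¹ : ℝ) : EReal) := fun N =>
    EReal.coe_nonneg.2 (by positivity)
  refine tendsto_order.2 ⟨fun b hb => ?_, fun b hb => ?_⟩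
  · obtain ⟨l, hbl, hlL⟩ := EReal.lt_iff_exists_real_btwn.1 hb
    filter_upwards [hlow l (EReal.coe_lt_coe_iff.1 hlL), eventually_ge_atTop 1] with N hN hN1
    refine hbl.trans_le ?_
    rw [← hcancel N l hN1]
    exact mul_le_mul_of_nonneg_left ((hlog _).ge.trans (ENNReal.log_monotone hN)) (hnn N)
  · obtain ⟨l, hLl, hlb⟩ := EReal.lt_iff_exists_real_btwn.1 hb
    filter_upwards [hupp l (EReal.coe_lt_coe_iff.1 hLl), eventually_ge_atTop 1] with N hN hN1
    refine lt_of_le_of_lt ?_ hlb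
    rw [← hcancel N l hN1]
    exact mul_le_mul_of_nonneg_left ((ENNReal.log_monotone hN).trans (hlog _).le) (hnn N)

lemma le_ofReal_exp_toReal {a : ℝ≥0∞} (ha : a ≠ ⊤) : a ≤ ENNReal.ofReal (Real.exp a.toReal) :=
  (ENNReal.ofReal_toReal ha).ge.trans
    (ENNReal.ofReal_le_ofReal (by linarith [Real.add_one_le_exp a.toReal]))

lemma eventually_le_ZN (hd : 3 ≤ d) {β : ℝ} (hβ : 0 < β) {W : Esp d → ℝ} (hW : Continuous W)
    (hW0 : ∀ x, 0 ≤ W x) {e l : ℝ} (he0 : 0 ≤ e)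
    (he : ⨅ μ : ProbabilityMeasure (Esp d), meanEnergy d W μ = ENNReal.ofReal e)
    (hl : l < -(β / 2) * e) :
    ∀ᶠ N : ℕ in atTop, ENNReal.ofReal (Real.exp ((N : ℝ) ^ 2 * l)) ≤ ZN d N β W := by
  obtain ⟨a, hea, hal⟩ : ∃ a, e < a ∧ l < -(β / 2) * a := by
    have hlim : Tendsto (fun a => -(β / 2) * a) (𝓝[>] e) (𝓝 (-(β / 2) * e)) :=
      (Continuous.tendsto (by fun_prop) e).mono_left nhdsWithin_le_nhds
    exact (eventually_mem_nhdsWithin.and (hlim.eventually_const_lt hl)).exists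
  have ha0 : 0 < a := he0.trans_lt hea
  obtain ⟨μ, hμ⟩ := iInf_lt_iff.1 (he.trans_lt ((ENNReal.ofReal_lt_ofReal_iff ha0).2 hea))
  obtain ⟨ν, hν, ⟨M, hM, hνM⟩, hνa⟩ := exists_le_smul_volume_meanEnergy_lt hd hW hμ
  have hev : ∀ᶠ N : ℕ in atTop, M.toReal ≤ N * (-(β / 2) * a - l) :=
    (tendsto_natCast_atTop_atTop.atTop_mul_const (sub_pos.2 hal)).eventually_ge_atTop _
  filter_upwards [hev] with N hN
  have h := (exp_neg_meanEnergy_le_ZN (N := N) hd hβ hW.measurable hW0 hM hνM ha0.le hνa.le).trans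
    (mul_le_mul_left (pow_le_pow_left' (le_ofReal_exp_toReal hM) N) _)
  rw [← ENNReal.ofReal_pow (Real.exp_pos _).le, ← Real.exp_nat_mul] at h
  have h2 := mul_le_mul_right h (ENNReal.ofReal (Real.exp (-(N * M.toReal))))
  rw [← mul_assoc (ENNReal.ofReal (Real.exp (-(N * M.toReal)))),
    ← ENNReal.ofReal_mul (Real.exp_pos _).le, ← Real.exp_add,
    ← ENNReal.ofReal_mul (Real.exp_pos _).le, ← Real.exp_add, neg_add_cancel, Real.exp_zero,
    ENNReal.ofReal_one, one_mul] at h2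
  refine le_trans (ENNReal.ofReal_le_ofReal (Real.exp_le_exp.2 ?_)) h2
  have := mul_le_mul_of_nonneg_left hN (Nat.cast_nonneg (α := ℝ) N)
  nlinarith

lemma eventually_ZN_le (hd : 3 ≤ d) {β : ℝ} (hβ : 0 < β) {W : Esp d → ℝ} (hW : Continuous W)
    (hW0 : ∀ x, 0 ≤ W x) (hWlim : Tendsto W (cocompact (Esp d)) atTop) {N₀ : ℕ}
    (hfin : ∫⁻ x, ENNReal.ofReal (Real.exp (-(β / 2) * N₀ * W x)) ≠ ⊤) {e l : ℝ}
    (he : ⨅ μ : ProbabilityMeasure (Esp d), meanEnergy d W μ = ENNReal.ofReal e)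
    (hl : -(β / 2) * e < l) :
    ∀ᶠ N : ℕ in atTop, ZN d N β W ≤ ENNReal.ofReal (Real.exp ((N : ℝ) ^ 2 * l)) := by
  obtain ⟨a, hea, hal⟩ : ∃ a, a < e ∧ -(β / 2) * a < l := by
    have hlim : Tendsto (fun a => -(β / 2) * a) (𝓝[<] e) (𝓝 (-(β / 2) * e)) :=
      (Continuous.tendsto (by fun_prop) e).mono_left nhdsWithin_le_nhds
    exact (eventually_mem_nhdsWithin.and (hlim.eventually_lt_const hl)).exists
  obtain ⟨n, hn⟩ : ∃ n : ℕ, ∀ μ : ProbabilityMeasure (Esp d),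
      ENNReal.ofReal a ≤ cutEnergy d n W μ := by
    by_contra! h
    obtain ⟨μ, hμ⟩ := exists_meanEnergy_le_of_cutEnergy_le hW hWlim ENNReal.ofReal_ne_top
      fun n => (h n).imp fun μ hμ => hμ.le
    have ha0 : 0 < a := ENNReal.ofReal_pos.1 ((h 0).elim fun μ hμ => pos_of_gt hμ)
    exact ((ENNReal.ofReal_lt_ofReal_iff (ha0.trans hea)).2 hea).not_ge
      (he ▸ (iInf_le _ μ).trans hμ)
  set I := ∫⁻ x, ENNReal.ofReal (Real.exp (-(β / 2) * N₀ * W x))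
  have hlim : Tendsto (fun N : ℕ => -(β / 2) * ((1 - N₀ / N) * (a - n / N)) + I.toReal / N) atTop
      (𝓝 (-(β / 2) * ((1 - 0) * (a - 0)) + 0)) :=
    ((((tendsto_const_div_atTop_nhds_zero_nat (N₀ : ℝ)).const_sub 1).mul
      ((tendsto_const_div_atTop_nhds_zero_nat (n : ℝ)).const_sub a)).const_mul _).add
      (tendsto_const_div_atTop_nhds_zero_nat _)
  rw [sub_zero, sub_zero, one_mul, add_zero] at hlim
  filter_upwards [hlim.eventually_lt_const hal, eventually_ge_atTop N₀, eventually_ge_atTop 1]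
    with N hN hN₀ hN1
  have : NeZero N := ⟨by omega⟩
  have hNpos : (0 : ℝ) < N := by exact_mod_cast hN1
  refine (ZN_le hd hβ hW.measurable hW0 hN₀ hn hfin).trans
    ((mul_le_mul_right (pow_le_pow_left' (le_ofReal_exp_toReal hfin) N) _).trans ?_)
  rw [← ENNReal.ofReal_pow (Real.exp_pos _).le, ← Real.exp_nat_mul,
    ← ENNReal.ofReal_mul (Real.exp_pos _).le, ← Real.exp_add]
  refine ENNReal.ofReal_le_ofReal (Real.exp_le_exp.2 ?_)
  refine le_of_eq_of_le ?_ (mul_le_mul_of_nonneg_left hN.le (sq_nonneg (N : ℝ)))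
  field_simp

lemma ZN_add_const {N : ℕ} {β : ℝ} {V : Esp d → ℝ} (hV : Measurable V) (c : ℝ) :
    ZN d N β V = ENNReal.ofReal (Real.exp ((N : ℝ) ^ 2 * (β / 2 * c))) *
      ZN d N β (fun x => V x + c) := by
  have hm : Measurable (HN d N fun x => V x + c) := measurable_HN (by fun_prop)
  rw [ZN, ZN, ← lintegral_const_mul _ (by fun_prop)]
  refine lintegral_congr fun X => ?_
  rw [← ENNReal.ofReal_mul (Real.exp_pos _).le, ← Real.exp_add]
  congr 2
  simp only [HN, Finset.sum_add_distrib, Finset.sum_const, Finset.card_univ, Fintype.card_fin,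
    nsmul_eq_mul]
  ring

lemma IV_eq_meanEnergy_sub {V : Esp d → ℝ} (hV : Measurable V) {c : ℝ} (hc : 0 ≤ c)
    (hVc : ∀ x, 0 ≤ V x + c) (μ : Measure (Esp d)) [IsProbabilityMeasure μ] :
    IV d V μ = (meanEnergy d (fun x => V x + c) μ : EReal) - (c : EReal) := by
  have hB : ∫⁻ x, ENNReal.ofReal (-V x) ∂μ ≤ ENNReal.ofReal c :=
    (lintegral_mono fun x => ENNReal.ofReal_le_ofReal (by linarith [hVc x])).trans_eq
      (by simp : ∫⁻ _ : Esp d, ENNReal.ofReal c ∂μ = _)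
  have hsum : ∫⁻ x, ENNReal.ofReal (V x + c) ∂μ + ∫⁻ x, ENNReal.ofReal (-V x) ∂μ =
      ∫⁻ x, ENNReal.ofReal (V x) ∂μ + ENNReal.ofReal c := by
    rw [← lintegral_add_left (by fun_prop)]
    calc _ = ∫⁻ x, (ENNReal.ofReal (V x) + ENNReal.ofReal c) ∂μ := by
          refine lintegral_congr fun x => ?_
          rcases le_total 0 (V x) with h | h
          · rw [ENNReal.ofReal_of_nonpos (by linarith : -V x ≤ 0), add_zero,
              ENNReal.ofReal_add h hc]
          · rw [← ENNReal.ofReal_add (hVc x) (by linarith), ENNReal.ofReal_of_nonpos h, zero_add]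
            congr 1
            ring
      _ = _ := by rw [lintegral_add_left (by fun_prop)]; simp
  unfold IV eIntR meanEnergy
  generalize ∫⁻ x, ENNReal.ofReal (-V x) ∂μ = B at *
  generalize ∫⁻ x, ENNReal.ofReal (V x) ∂μ = A at *
  generalize ∫⁻ x, ENNReal.ofReal (V x + c) ∂μ = T at *
  have hBtop : B ≠ ⊤ := ne_top_of_le_ne_top ENNReal.ofReal_ne_top hB
  rw [EReal.coe_ennreal_add, sub_eq_add_neg (_ + _), add_assoc, ← sub_eq_add_neg]
  congr 1
  lift B to NNReal using hBtop
  have hcr : ENNReal.ofReal c = ((c.toNNReal : NNReal) : ℝ≥0∞) := rfl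
  rcases eq_or_ne A ⊤ with rfl | hA
  · have hT : T = ⊤ := by simpa using hsum
    subst hT
    simp
  · have hT : T ≠ ⊤ := fun h => by simp [h, hA, hcr, eq_comm] at hsum
    lift A to NNReal using hA
    lift T to NNReal using hT
    rw [hcr] at hsum
    have h : (T : ℝ) + B = A + c := by
      have h' : T + B = A + c.toNNReal := by exact_mod_cast hsum
      have h'' := congrArg NNReal.toReal h'
      simpa [Real.coe_toNNReal c hc] using h''
    have hcoe : ∀ t : NNReal, (((t : ℝ≥0∞)) : EReal) = ((t : ℝ) : EReal) := fun _ => rfl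
    rw [hcoe, hcoe, hcoe, ← EReal.coe_sub, ← EReal.coe_sub, EReal.coe_eq_coe_iff]
    linarith

lemma iInf_IV {V : Esp d → ℝ} (hV : Measurable V) {c : ℝ} (hc : 0 ≤ c)
    (hVc : ∀ x, 0 ≤ V x + c) :
    ⨅ μ : ProbabilityMeasure (Esp d), IV d V μ =
      ((⨅ μ : ProbabilityMeasure (Esp d), meanEnergy d (fun x => V x + c) μ : ℝ≥0∞) : EReal) -
        (c : EReal) := by
  simp_rw [IV_eq_meanEnergy_sub hV hc hVc]
  refine (Monotone.map_iInf_of_continuousAt (f := fun t : ℝ≥0∞ => (t : EReal) - (c : EReal))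
    (Continuous.continuousAt ?_) (fun s t h => ?_) ?_).symm
  · exact continuous_iff_continuousAt.2 fun t => by
      simp_rw [sub_eq_add_neg, ← EReal.coe_neg]
      exact ContinuousAt.comp (f := fun t : ℝ≥0∞ => ((t : EReal), ((-c : ℝ) : EReal)))
        (EReal.continuousAt_add (Or.inr (EReal.coe_ne_bot _)) (Or.inr (EReal.coe_ne_top _)))
        (continuous_coe_ennreal_ereal.prodMk continuous_const).continuousAt
  · exact EReal.sub_le_sub (EReal.coe_ennreal_le_coe_ennreal_iff.2 h) le_rfl
  · simp

lemma tendsto_potential (hd : 3 ≤ d) {β : ℝ} (hβ : 0 < β) {V : Esp d → ℝ} {N : ℕ}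
    (hfin : ∫⁻ x : Esp d, ENNReal.ofReal (Real.exp (-(β / 2) * N * V x)) ≠ ⊤) {α : ℝ}
    (hgrowth : Tendsto (fun x : Esp d => (1 - α) * V x / 2 + gC d x) (cocompact (Esp d)) atTop) :
    Tendsto V (cocompact (Esp d)) atTop := by
  have : Nonempty (Fin d) := ⟨⟨0, by omega⟩⟩
  have hg : ∀ᶠ x in cocompact (Esp d), gC d x ≤ 1 := by
    filter_upwards [tendsto_norm_cocompact_atTop.eventually_ge_atTop 1] with x hx
    have hd' : (3 : ℝ) ≤ d := by exact_mod_cast hd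
    exact Real.rpow_le_one_of_one_le_of_nonpos hx (by linarith)
  have hlim : Tendsto (fun x => (1 - α) * V x) (cocompact (Esp d)) atTop := by
    refine tendsto_atTop.2 fun b => ?_
    filter_upwards [hg, hgrowth.eventually_ge_atTop (b / 2 + 1)] with x h1 h2
    linarith
  rcases lt_trichotomy (1 - α) 0 with h | h | h
  · exfalso
    obtain ⟨K, hK, hKV⟩ := mem_cocompact.1 (hlim.eventually_ge_atTop 0)
    have hle : volume Kᶜ ≤ ∫⁻ x : Esp d, ENNReal.ofReal (Real.exp (-(β / 2) * N * V x)) := by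
      rw [← setLIntegral_one]
      refine (setLIntegral_mono' hK.measurableSet.compl fun x hx => ?_).trans
        (setLIntegral_le_lintegral _ _)
      have hx' : V x ≤ 0 := by
        have h0 : 0 ≤ (1 - α) * V x := hKV hx
        nlinarith
      rw [ENNReal.one_le_ofReal, Real.one_le_exp_iff, neg_mul, neg_mul, ← mul_neg]
      exact mul_nonneg (by positivity) (neg_nonneg.2 hx')
    have htop := measure_add_measure_compl (μ := (volume : Measure (Esp d))) hK.measurableSet
    rw [measure_univ_of_isAddLeftInvariant] at htop
    exact ENNReal.add_ne_top.2 ⟨hK.measure_lt_top.ne, ne_top_of_le_ne_top hfin hle⟩ htop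
  · simp only [h, zero_mul] at hlim
    obtain ⟨x, hx⟩ := (hlim.eventually_ge_atTop 1).exists
    linarith
  · exact (tendsto_const_mul_atTop_of_pos h).1 hlim

lemma exists_forall_add_nonneg {V : Esp d → ℝ} (hV : Continuous V)
    (hVlim : Tendsto V (cocompact (Esp d)) atTop) : ∃ c : ℝ, 0 ≤ c ∧ ∀ x, 0 ≤ V x + c := by
  obtain ⟨x₀, hx₀⟩ := hV.exists_forall_le hVlim
  exact ⟨|V x₀|, abs_nonneg _, fun x => by linarith [hx₀ x, neg_abs_le (V x₀)]⟩

end Asymptotics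

/-- first-order expansion of the partition function:
`(1/N²) log Z_{N,β} → -(β/2) min_{P(ℝ^d)} I_V` as `N → ∞`, for the Coulomb gas in
dimension `d ≥ 3`. -/
theorem statement_5 (d : ℕ) (hd : 3 ≤ d) (β : ℝ) (hβ : 0 < β) (V : Esp d → ℝ)
    (hV : Continuous V)
    (hint : ∃ N₀ : ℕ, ∀ N ≥ N₀,
      (∫⁻ x : Esp d, ENNReal.ofReal (Real.exp (-(β / 2) * N * V x))) ≠ ⊤)
    (hgrowth : ∃ α₀ : ℝ, 0 < α₀ ∧
      Tendsto (fun x : Esp d => (1 - α₀) * V x / 2 + gC d x) (cocompact (Esp d)) atTop) :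
    Tendsto (fun N : ℕ => ((((N : ℝ) ^ 2)⁻¹ : ℝ) : EReal) * ENNReal.log (ZN d N β V)) atTop
      (𝓝 (((-(β / 2) : ℝ) : EReal) *
        ⨅ ν : ProbabilityMeasure (Esp d), IV d V (ν : Measure (Esp d)))) := by
  obtain ⟨N₀, hN₀⟩ := hint
  obtain ⟨α, -, hα⟩ := hgrowth
  have hVlim := tendsto_potential hd hβ (hN₀ N₀ le_rfl) hα
  obtain ⟨c, hc, hVc⟩ := exists_forall_add_nonneg hV hVlim
  have hW : Continuous fun x => V x + c := by fun_prop
  have hWfin : ∫⁻ x, ENNReal.ofReal (Real.exp (-(β / 2) * N₀ * (V x + c))) ≠ ⊤ := by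
    refine ne_top_of_le_ne_top (hN₀ N₀ le_rfl) (lintegral_mono fun x =>
      ENNReal.ofReal_le_ofReal (Real.exp_le_exp.2 ?_))
    have : 0 ≤ β / 2 * N₀ * c := by positivity
    linarith
  set E := ⨅ μ : ProbabilityMeasure (Esp d), meanEnergy d (fun x => V x + c) μ with hE
  have hEtop : E ≠ ⊤ := ne_top_of_le_ne_top (meanEnergy_ballUniform_ne_top hd hW)
    (iInf_le _ (⟨ballUniform d, inferInstance⟩ : ProbabilityMeasure (Esp d)))
  have hEreal : E = ENNReal.ofReal E.toReal := (ENNReal.ofReal_toReal hEtop).symm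
  have hlimit : ((-(β / 2) : ℝ) : EReal) * ⨅ ν : ProbabilityMeasure (Esp d), IV d V ν =
      ((-(β / 2) * (E.toReal - c) : ℝ) : EReal) := by
    rw [iInf_IV hV.measurable hc hVc, ← hE, ← EReal.coe_ennreal_toReal hEtop, ← EReal.coe_sub,
      ← EReal.coe_mul]
  rw [hlimit]
  have hshift : ∀ (N : ℕ) (l : ℝ), ENNReal.ofReal (Real.exp ((N : ℝ) ^ 2 * l)) =
      ENNReal.ofReal (Real.exp ((N : ℝ) ^ 2 * (β / 2 * c))) *
        ENNReal.ofReal (Real.exp ((N : ℝ) ^ 2 * (l - β / 2 * c))) := fun N l => by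
    rw [← ENNReal.ofReal_mul (Real.exp_pos _).le, ← Real.exp_add]
    congr 2
    ring
  refine tendsto_inv_sq_mul_log (fun l hl => ?_) fun l hl => ?_
  · filter_upwards [eventually_le_ZN hd hβ hW hVc ENNReal.toReal_nonneg hEreal
      (l := l - β / 2 * c) (by linarith)] with N hN
    rw [hshift, ZN_add_const hV.measurable c]
    gcongr
  · filter_upwards [eventually_ZN_le hd hβ hW hVc (tendsto_atTop_add_const_right _ c hVlim)
      hWfin hEreal (l := l - β / 2 * c) (by linarith)] with N hN
    rw [hshift, ZN_add_const hV.measurable c]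
    gcongr
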